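/- arXiv:2111.14234 — 5 statements merged into one kernel-verified Lean document; each statement's English description precedes it below -/
import Mathlib

section
/- Let n ≥ 4 be an integer and define the iteration k_0 = π(n), k_{j+1} = π(n − k_j) for j ≥ 0. Then exactly one of the following occurs after finitely many steps: (i) there exist an integer k* and an index J such that k_j = k* for all j ≥ J (a fixed point, with π(n − k*) = k*); or (ii) there exist an integer k' ≥ 1 and an index J such that n − k' is a prime number and k_{2j+1} = k' and k_{2j} = k' + 1 for all j ≥ J (a 2-cycle {k', k'+1}). -/
/-- `p k` is the `k`-th prime number (`p 1 = 2`, `p 2 = 3`, ...). -/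
noncomputable def p (k : ℕ) : ℕ := Nat.nth Nat.Prime (k - 1)

/-- The iteration `k₀ = π(n)`, `k_{j+1} = π(n - k_j)`. -/
noncomputable def kseq (n : ℕ) : ℕ → ℕ
  | 0 => Nat.primeCounting n
  | j + 1 => Nat.primeCounting (n - kseq n j)

theorem primeCounting_succ (m : ℕ) :
    Nat.primeCounting (m + 1) = Nat.primeCounting m + if Nat.Prime (m + 1) then 1 else 0 :=
  Nat.count_succ _ _

theorem primeCounting_add_le_add (m d : ℕ) :
    Nat.primeCounting (m + d) ≤ Nat.primeCounting m + d := by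
  induction d with
  | zero => simp
  | succ d ih =>
    rw [← add_assoc, primeCounting_succ]
    split_ifs <;> omega

theorem primeCounting_le_sub_two {n : ℕ} (hn : 4 ≤ n) : Nat.primeCounting n ≤ n - 2 := by
  obtain ⟨d, rfl⟩ := Nat.exists_eq_add_of_le hn
  have h4 : Nat.primeCounting 4 = 2 := by decide
  have := primeCounting_add_le_add 4 d
  omega

theorem eq_one_of_prime_succ_of_prime_add_two {m : ℕ} (h₁ : Nat.Prime (m + 1))
    (h₂ : Nat.Prime (m + 2)) : m = 1 := by
  rcases h₁.eq_two_or_odd with h | h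
  · omega
  · rcases h₂.eq_two_or_odd with h' | h'
    · have := h₁.two_le
      omega
    · omega

theorem antitone_primeCounting_sub (n : ℕ) : Antitone fun k => Nat.primeCounting (n - k) :=
  fun _ _ h => Nat.monotone_primeCounting (Nat.sub_le_sub_left h n)

theorem kseq_le_zero (n j : ℕ) : kseq n j ≤ kseq n 0 := by
  cases j with
  | zero => exact le_rfl
  | succ j => exact Nat.monotone_primeCounting (Nat.sub_le _ _)

theorem kseq_even_antitone (n : ℕ) : Antitone fun j => kseq n (2 * j) := by
  refine antitone_nat_of_succ_le fun j => ?_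
  induction j with
  | zero => exact kseq_le_zero n _
  | succ j ih =>
    exact antitone_primeCounting_sub n (antitone_primeCounting_sub n ih)

theorem kseq_odd_le_even (n j : ℕ) : kseq n (2 * j + 1) ≤ kseq n (2 * j) := by
  induction j with
  | zero => exact kseq_le_zero n _
  | succ j ih =>
    exact antitone_primeCounting_sub n (antitone_primeCounting_sub n ih)

/-- The even-indexed terms stabilize at some `b` and the odd-indexed terms at some `a ≤ b`. -/
theorem exists_kseq_eventually_eq (n : ℕ) : ∃ a b J : ℕ, a ≤ b ∧ b ≤ Nat.primeCounting n ∧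
    Nat.primeCounting (n - a) = b ∧ Nat.primeCounting (n - b) = a ∧
    ∀ j, J ≤ j → kseq n (2 * j + 1) = a ∧ kseq n (2 * j) = b := by
  obtain ⟨J, hJ⟩ := WellFoundedLT.antitone_chain_condition (kseq_even_antitone n)
  have hodd (j : ℕ) (hj : J ≤ j) : kseq n (2 * j + 1) = kseq n (2 * J + 1) :=
    congrArg (fun k => Nat.primeCounting (n - k)) (hJ j hj).symm
  exact ⟨kseq n (2 * J + 1), kseq n (2 * J), J, kseq_odd_le_even n J, kseq_le_zero n _,
    (hJ (J + 1) (Nat.le_succ J)).symm, rfl, fun j hj => ⟨hodd j hj, (hJ j hj).symm⟩⟩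

/-- A pair swapped by `k ↦ π(n - k)` is either a fixed point or consists of
consecutive integers. -/
theorem le_add_one_of_swap {n a b : ℕ} (hn : 4 ≤ n) (hb : b ≤ Nat.primeCounting n)
    (hfa : Nat.primeCounting (n - a) = b) (hfb : Nat.primeCounting (n - b) = a) :
    b ≤ a + 1 := by
  by_contra! hlt
  have hπ := primeCounting_le_sub_two hn
  obtain ⟨m, hm⟩ : ∃ m, n - b = m := ⟨_, rfl⟩
  obtain ⟨d, hd⟩ : ∃ d, b = a + 2 + d := Nat.exists_eq_add_of_le hlt
  have hna : n - a = m + 2 + d := by omega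
  rw [hm] at hfb
  rw [hna] at hfa
  have hle := primeCounting_add_le_add (m + 2) d
  have h₁ := primeCounting_succ m
  have h₂ : Nat.primeCounting (m + 2) = _ := primeCounting_succ (m + 1)
  have hp₁ : Nat.Prime (m + 1) := by
    by_contra h
    rw [if_neg h] at h₁
    split_ifs at h₂ <;> omega
  have hp₂ : Nat.Prime (m + 2) := by
    by_contra h
    rw [if_neg h] at h₂
    split_ifs at h₁ <;> omega
  have := eq_one_of_prime_succ_of_prime_add_two hp₁ hp₂
  omega

theorem prime_sub_of_swap {n a : ℕ} (hn : a + 1 ≤ n)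
    (hfa : Nat.primeCounting (n - a) = a + 1) (hfb : Nat.primeCounting (n - (a + 1)) = a) :
    Nat.Prime (n - a) := by
  have hna : n - a = n - (a + 1) + 1 := by omega
  rw [hna] at hfa ⊢
  by_contra h
  rw [primeCounting_succ, if_neg h] at hfa
  omega

theorem stmt_0 (n : ℕ) (hn : 4 ≤ n) :
    Xor'
      (∃ kstar J : ℕ, (∀ j, J ≤ j → kseq n j = kstar) ∧
        Nat.primeCounting (n - kstar) = kstar)
      (∃ k' J : ℕ, 1 ≤ k' ∧ Nat.Prime (n - k') ∧
        (∀ j, J ≤ j → kseq n (2 * j + 1) = k' ∧ kseq n (2 * j) = k' + 1)) := by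
  obtain ⟨a, b, J, hab, hb, hfa, hfb, hJ⟩ := exists_kseq_eventually_eq n
  have hπ := primeCounting_le_sub_two hn
  rcases hab.eq_or_lt with rfl | hlt
  · refine Or.inl ⟨⟨a, 2 * J, fun j hj => ?_, hfa⟩, ?_⟩
    · rcases Nat.even_or_odd' j with ⟨i, rfl | rfl⟩
      · exact (hJ i (by omega)).2
      · exact (hJ i (by omega)).1
    · rintro ⟨k', J', -, -, hJ'⟩
      have h := hJ (max J J') (le_max_left _ _)
      have h' := hJ' (max J J') (le_max_right _ _)
      omega
  · obtain rfl : b = a + 1 := le_antisymm (le_add_one_of_swap hn hb hfa hfb) hlt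
    refine Or.inr ⟨⟨a, J, ?_, prime_sub_of_swap (by omega) hfa hfb, hJ⟩, ?_⟩
    · by_contra! ha
      obtain rfl : a = 0 := by omega
      have h4 : Nat.primeCounting 4 = 2 := by decide
      have := Nat.monotone_primeCounting hn
      rw [Nat.sub_zero] at hfa
      omega
    · rintro ⟨k, J', hJ', -⟩
      have h := hJ (max J J') (le_max_left _ _)
      have h₀ := hJ' (2 * max J J') (by omega)
      have h₁ := hJ' (2 * max J J' + 1) (by omega)
      omega
end

section
/- Let n ≥ 4 be an integer and let k' ≥ 1 be an integer such that π(n − k' − 1) = k' and π(n − k') = k' + 1. Then n − k' is prime with p_{k'+1} = n − k', and k' + p_{k'} < n < (k' + 1) + p_{k'+1}; consequently there is no positive integer k with n = k + p_k. -/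
theorem p_strictMono {a b : ℕ} (ha : 1 ≤ a) (hab : a < b) : p a < p b :=
  Nat.nth_strictMono Nat.infinite_setOfPred_prime (by omega)

theorem p_mono {a b : ℕ} (hab : a ≤ b) : p a ≤ p b :=
  (Nat.nth_strictMono Nat.infinite_setOfPred_prime).monotone (by omega)

theorem stmt_6 (n k' : ℕ) (hn : 4 ≤ n) (hk' : 1 ≤ k')
    (h1 : Nat.primeCounting (n - k' - 1) = k')
    (h2 : Nat.primeCounting (n - k') = k' + 1) :
    Nat.Prime (n - k') ∧ p (k' + 1) = n - k' ∧
      k' + p k' < n ∧ n < (k' + 1) + p (k' + 1) ∧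
      ¬ ∃ k : ℕ, 1 ≤ k ∧ n = k + p k := by
  rw [Nat.primeCounting_sub_one, Nat.primeCounting'] at h1
  have hprime : Nat.Prime (n - k') := by
    by_contra h
    rw [Nat.primeCounting, Nat.primeCounting', Nat.count_succ, if_neg h] at h2
    omega
  have hp : p (k' + 1) = n - k' := by
    have h := Nat.nth_count hprime
    rwa [h1] at h
  have hpos := hprime.pos
  have hlt := p_strictMono hk' (Nat.lt_add_one k')
  refine ⟨hprime, hp, by omega, by omega, ?_⟩
  rintro ⟨k, -, hk⟩
  rcases Nat.lt_or_ge k' k with h | h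
  · have := p_mono (Nat.add_one_le_iff.mpr h)
    omega
  · have := p_mono h
    omega
end

section
/- Let n ≥ 4 be an integer and define the iteration k_0 = π(n), k_{j+1} = π(n − k_j) for j ≥ 0. Then the equation n = k + p_k has a solution in positive integers k if and only if the iteration is eventually constant at some value k* and k* + p_{k*} = n; and in that case k = k* is the unique solution. -/
theorem primeCounting_add_le_add_s10 (a e : ℕ) :
    Nat.primeCounting (a + e) ≤ Nat.primeCounting a + e := by
  induction e with
  | zero => simp
  | succ e ih =>
    have h : Nat.primeCounting (a + e + 1) ≤ Nat.primeCounting (a + e) + 1 := by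
      simp only [Nat.primeCounting, Nat.primeCounting']
      rw [Nat.count_succ Nat.Prime (a + e + 1)]
      split_ifs <;> omega
    rw [← add_assoc]
    omega

theorem primeCounting_succ_of_prime {q : ℕ} (hq : q.Prime) (h2 : q ≠ 2) :
    Nat.primeCounting (q + 1) = Nat.primeCounting q := by
  have hnot : ¬ (q + 1).Prime := fun h => by
    have h3 := hq.eq_two_or_odd
    have h4 := h.eq_two_or_odd
    have h5 := hq.two_le
    omega
  simp only [Nat.primeCounting, Nat.primeCounting']
  rw [Nat.count_succ Nat.Prime (q + 1), if_neg hnot, add_zero]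

theorem primeCounting_add_lt_add {q e : ℕ} (hq : q.Prime) (h2 : q ≠ 2) (he : 1 ≤ e) :
    Nat.primeCounting (q + e) < Nat.primeCounting q + e := by
  obtain ⟨d, rfl⟩ := Nat.exists_eq_add_of_le he
  have h := primeCounting_add_le_add_s10 (q + 1) d
  rw [primeCounting_succ_of_prime hq h2] at h
  rw [← add_assoc]
  omega

theorem prime_p (k : ℕ) : (p k).Prime := Nat.prime_nth_prime _

theorem p_mono_s10 : Monotone p := fun _ _ h =>
  Nat.nth_monotone Nat.infinite_setOfPred_prime (Nat.sub_le_sub_right h 1)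

theorem primeCounting_p {k : ℕ} (hk : 1 ≤ k) : Nat.primeCounting (p k) = k := by
  have h := Nat.primeCounting'_nth_eq (k - 1)
  have hp := prime_p k
  simp only [p, Nat.primeCounting, Nat.primeCounting'] at *
  rw [Nat.count_succ, if_pos hp]
  omega

theorem p_zero : p 0 = 2 := Nat.nth_prime_zero_eq_two

theorem p_one : p 1 = 2 := Nat.nth_prime_zero_eq_two

theorem add_p_injective : Function.Injective fun k => k + p k :=
  (strictMono_id.add_monotone p_mono_s10).injective

theorem primeCounting_sub_le {n k x : ℕ} (hk : 1 ≤ k) (hn : n = k + p k) (hx : k ≤ x) :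
    Nat.primeCounting (n - x) ≤ k ∧ k ≤ Nat.primeCounting (n - x) + (x - k) := by
  have hp := primeCounting_p hk
  constructor
  · calc Nat.primeCounting (n - x) ≤ Nat.primeCounting (p k) :=
          Nat.monotone_primeCounting (by omega)
      _ = k := hp
  · calc k = Nat.primeCounting (p k) := hp.symm
      _ ≤ Nat.primeCounting (n - x + (x - k)) := Nat.monotone_primeCounting (by omega)
      _ ≤ _ := primeCounting_add_le_add_s10 _ _

theorem le_primeCounting_sub {n k x : ℕ} (hk : 1 ≤ k) (h2 : p k ≠ 2) (hn : n = k + p k)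
    (hx : x < k) :
    k ≤ Nat.primeCounting (n - x) ∧ Nat.primeCounting (n - x) < k + (k - x) := by
  have hp := primeCounting_p hk
  have hlt := primeCounting_add_lt_add (prime_p k) h2 (e := k - x) (by omega)
  have hle : Nat.primeCounting (p k) ≤ Nat.primeCounting (p k + (k - x)) :=
    Nat.monotone_primeCounting (by omega)
  rw [show n - x = p k + (k - x) by omega]
  omega

theorem exists_kseq_eq {n k : ℕ} (hk : 1 ≤ k) (h2 : p k ≠ 2) (hn : n = k + p k) (D : ℕ) :
    ∀ j, k ≤ kseq n j → kseq n j ≤ k + D → ∃ J, kseq n J = k := by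
  induction D with
  | zero => exact fun j h h' => ⟨j, by omega⟩
  | succ D ih =>
    intro j h h'
    obtain ⟨hle, hge⟩ : kseq n (j + 1) ≤ k ∧ k ≤ kseq n (j + 1) + (kseq n j - k) :=
      primeCounting_sub_le hk hn h
    rcases hle.eq_or_lt with heq | hlt
    · exact ⟨j + 1, heq⟩
    · obtain ⟨hk2, hlt2⟩ : k ≤ kseq n (j + 2) ∧ kseq n (j + 2) < k + (k - kseq n (j + 1)) :=
        le_primeCounting_sub hk h2 hn hlt
      exact ih (j + 2) hk2 (by omega)

theorem kseq_eq_of_le {n k J : ℕ} (hk : 1 ≤ k) (hn : n = k + p k) (hJ : kseq n J = k) :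
    ∀ j, J ≤ j → kseq n j = k := by
  intro j hj
  induction j, hj using Nat.le_induction with
  | base => exact hJ
  | succ j _ ih =>
    rw [kseq, ih, show n - k = p k by omega, primeCounting_p hk]

theorem stmt_10 (n : ℕ) (hn : 4 ≤ n) :
    ((∃ k : ℕ, 1 ≤ k ∧ n = k + p k) ↔
      (∃ kstar J : ℕ, (∀ j, J ≤ j → kseq n j = kstar) ∧ kstar + p kstar = n)) ∧
    (∀ kstar J : ℕ, (∀ j, J ≤ j → kseq n j = kstar) → kstar + p kstar = n →
      ∀ k : ℕ, 1 ≤ k → n = k + p k → k = kstar) := by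
  refine ⟨⟨?_, ?_⟩, ?_⟩
  · rintro ⟨k, hk, hnk⟩
    have h2 : p k ≠ 2 := fun h => by
      have hk1 : k = 1 := by
        rw [← primeCounting_p hk, h, ← p_one, primeCounting_p le_rfl]
      omega
    have h0 : k ≤ kseq n 0 := by
      calc k = Nat.primeCounting (p k) := (primeCounting_p hk).symm
        _ ≤ Nat.primeCounting n := Nat.monotone_primeCounting (by omega)
    obtain ⟨J, hJ⟩ := exists_kseq_eq hk h2 hnk (kseq n 0) 0 h0 (by omega)
    exact ⟨k, J, kseq_eq_of_le hk hnk hJ, hnk.symm⟩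
  · rintro ⟨k, -, -, hk⟩
    refine ⟨k, Nat.one_le_iff_ne_zero.mpr fun h => ?_, hk.symm⟩
    rw [h, p_zero] at hk
    omega
  · intro kstar _ _ hstar k _ hk
    exact add_p_injective (hk.symm.trans hstar.symm)
end

section
/- Fix integers a ≥ 1, b ≥ 1, and let n be a positive integer; define the iteration k_0 = π(⌊n/b⌋), k_{j+1} = π(⌊(n − a·k_j)/b⌋) for j ≥ 0, and assume the admissibility condition k_1 = π(⌊(n − a·π(⌊n/b⌋))/b⌋) ≥ 1. Then k_j ≥ 1 for all j ≥ 1, for every j ≥ 0 one has k_{2j+1} ≤ k_{2j} and k_{2j+2} ≥ k_{2j+1}, the subsequence (k_{2j})_{j≥0} is nonincreasing, the subsequence (k_{2j+1})_{j≥0} is nondecreasing, and there exist integers k' ≤ k'' and an index J such that k_{2j+1} = k' and k_{2j} = k'' for all j ≥ J. -/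
/-- The generalized iteration `k₀ = π(⌊n/b⌋)`, `k_{j+1} = π(⌊(n - a·k_j)/b⌋)`. -/
noncomputable def kseqG (a b n : ℕ) : ℕ → ℕ
  | 0 => Nat.primeCounting (n / b)
  | j + 1 => Nat.primeCounting ((n - a * kseqG a b n j) / b)

theorem kseqG_succ_le_succ {a b n i j : ℕ} (h : kseqG a b n i ≤ kseqG a b n j) :
    kseqG a b n (j + 1) ≤ kseqG a b n (i + 1) := by
  simp only [kseqG]
  exact Nat.monotone_primeCounting
    (Nat.div_le_div_right (Nat.sub_le_sub_left (Nat.mul_le_mul_left a h) n))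

theorem kseqG_le_zero (a b n j : ℕ) : kseqG a b n j ≤ kseqG a b n 0 := by
  cases j with
  | zero => exact le_rfl
  | succ j =>
    simp only [kseqG]
    exact Nat.monotone_primeCounting (Nat.div_le_div_right (Nat.sub_le _ _))

theorem kseqG_odd_le_even (a b n j : ℕ) :
    kseqG a b n (2 * j + 1) ≤ kseqG a b n (2 * j) := by
  induction j with
  | zero => exact kseqG_le_zero a b n 1
  | succ j ih => exact kseqG_succ_le_succ (kseqG_succ_le_succ ih)

theorem kseqG_even_antitone (a b n : ℕ) : Antitone (fun j : ℕ => kseqG a b n (2 * j)) := by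
  refine antitone_nat_of_succ_le fun j => ?_
  induction j with
  | zero => exact kseqG_le_zero a b n 2
  | succ j ih => exact kseqG_succ_le_succ (kseqG_succ_le_succ ih)

theorem stmt_11 (a b n : ℕ) (ha : 1 ≤ a) (hb : 1 ≤ b) (hn : 0 < n)
    (hadm : 1 ≤ Nat.primeCounting ((n - a * Nat.primeCounting (n / b)) / b)) :
    (∀ j : ℕ, 1 ≤ j → 1 ≤ kseqG a b n j) ∧
    (∀ j : ℕ, kseqG a b n (2 * j + 1) ≤ kseqG a b n (2 * j) ∧
      kseqG a b n (2 * j + 1) ≤ kseqG a b n (2 * j + 2)) ∧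
    Antitone (fun j : ℕ => kseqG a b n (2 * j)) ∧
    Monotone (fun j : ℕ => kseqG a b n (2 * j + 1)) ∧
    (∃ k' k'' J : ℕ, k' ≤ k'' ∧
      ∀ j, J ≤ j → kseqG a b n (2 * j + 1) = k' ∧ kseqG a b n (2 * j) = k'') := by
  refine ⟨fun j hj => ?_,
    fun j => ⟨kseqG_odd_le_even a b n j, kseqG_succ_le_succ (kseqG_odd_le_even a b n j)⟩,
    kseqG_even_antitone a b n,
    fun i j hij => kseqG_succ_le_succ (kseqG_even_antitone a b n hij), ?_⟩
  · obtain ⟨i, rfl⟩ := Nat.exists_eq_add_of_le' hj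
    have h : 1 ≤ kseqG a b n 1 := by simpa only [kseqG] using hadm
    exact h.trans (kseqG_succ_le_succ (kseqG_le_zero a b n i))
  · obtain ⟨J, hJ⟩ := WellFoundedGT.monotone_chain_condition
      (α := ℕᵒᵈ) ⟨fun j => kseqG a b n (2 * j), kseqG_even_antitone a b n⟩
    have heven : ∀ j, J ≤ j → kseqG a b n (2 * j) = kseqG a b n (2 * J) :=
      fun j hj => (hJ j hj).symm
    refine ⟨_, _, J, kseqG_odd_le_even a b n J, fun j hj => ⟨?_, heven j hj⟩⟩
    simp only [kseqG, heven j hj]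
end

section
/- Fix integers a ≥ 1, b ≥ 1, and a positive integer n, and let k', k'' be integers with 1 ≤ k' < k'' such that π(⌊(n − a·k'')/b⌋) = k' and π(⌊(n − a·k')/b⌋) = k''. Then (2b − a)·(k'' − k') < 2b (as an inequality of integers, where 2b − a may be negative). -/
/-- Beyond `2` every prime is odd, so primes in `(x, y]` are at most as many as odd numbers there. -/
theorem primeCounting_add_half_le {x y : ℕ} (hx : 2 ≤ x) (hxy : x ≤ y) :
    Nat.primeCounting y + (x + 1) / 2 ≤ Nat.primeCounting x + (y + 1) / 2 := by
  induction y, hxy using Nat.le_induction with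
  | base => exact le_rfl
  | succ m hm ih =>
    have hsucc : Nat.primeCounting (m + 1) =
        Nat.primeCounting m + if (m + 1).Prime then 1 else 0 :=
      Nat.count_succ Nat.Prime (m + 1)
    split_ifs at hsucc with hp
    · have := hp.eq_two_or_odd
      omega
    · omega

theorem stmt_12 (a b n k' k'' : ℕ) (ha : 1 ≤ a) (hb : 1 ≤ b) (hn : 0 < n)
    (hk' : 1 ≤ k') (hlt : k' < k'')
    (h1 : Nat.primeCounting ((n - a * k'') / b) = k')
    (h2 : Nat.primeCounting ((n - a * k') / b) = k'') :
    ((2 * b : ℤ) - a) * ((k'' : ℤ) - k') < 2 * b := by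
  have hak : a * k' ≤ a * k'' := Nat.mul_le_mul_left a hlt.le
  set x := (n - a * k'') / b with hx
  set y := (n - a * k') / b with hy
  have hx2 : 2 ≤ x := by
    by_contra! h
    have := Nat.primeCounting_eq_zero_iff.mpr (Nat.le_of_lt_succ h)
    omega
  have hxy : x ≤ y := Nat.div_le_div_right (by omega)
  have hcount : 2 * k'' + x ≤ 2 * k' + y + 1 := by
    have := primeCounting_add_half_le hx2 hxy
    omega
  have hbx : n - a * k'' < b * (x + 1) := Nat.lt_mul_div_succ _ hb
  have hby : b * y ≤ n - a * k' := Nat.mul_div_le _ _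
  have hpos : 0 < n - a * k'' := Nat.pos_of_ne_zero fun h => by simp [hx, h] at hx2
  have hdiff : b * y + a * k' < b * (x + 1) + a * k'' := by omega
  zify at hcount hdiff hb
  nlinarith
end
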